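/- Let m ≥ 4 be even and let DA_m = ⟨s,t ∣ π(s,t;m) = π(t,s;m)⟩ be the dihedral Artin group on an edge labeled m. Then Out(DA_m) is isomorphic to C₂ × D∞, the direct product of the cyclic group of order 2 with the infinite dihedral group (in Mathlib, DihedralGroup 0). -/

import Mathlib

/-- The alternating product `a * b * a * ⋯` with `n` factors. -/
def altProd {M : Type*} [Monoid M] : M → M → ℕ → M
  | _, _, 0 => 1
  | a, b, n + 1 => a * altProd b a n

/-- The single Artin relation `π(s,t;m) = π(t,s;m)` of the dihedral Artin group `DA_m`,
with `s = true` and `t = false`. -/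
def dihedralArtinRels (m : ℕ) : Set (FreeGroup Bool) :=
  {altProd (FreeGroup.of true) (FreeGroup.of false) m *
    (altProd (FreeGroup.of false) (FreeGroup.of true) m)⁻¹}

/-- The dihedral Artin group `DA_m = ⟨s,t ∣ π(s,t;m) = π(t,s;m)⟩`. -/
abbrev DihedralArtinGroup (m : ℕ) : Type := PresentedGroup (dihedralArtinRels m)

/-- The subgroup of inner automorphisms of a group. -/
def innerAutSubgroup (G : Type*) [Group G] : Subgroup (MulAut G) :=
  (MulAut.conj (G := G)).range

instance innerAutSubgroup_normal (G : Type*) [Group G] : (innerAutSubgroup G).Normal := by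
  constructor
  rintro f ⟨g, rfl⟩ φ
  refine ⟨φ g, ?_⟩
  ext x
  simp only [MulAut.conj_apply, MulAut.mul_apply, MulAut.inv_def, map_mul, map_inv,
    MulEquiv.apply_symm_apply]

/-- The outer automorphism group of a group: the quotient of the automorphism group by the
normal subgroup of inner automorphisms. -/
abbrev Out (G : Type*) [Group G] : Type _ := MulAut G ⧸ innerAutSubgroup G

namespace FreeGroup

section Words

variable {A : Type*} [AddCommGroup A]

/-- The concatenation of two words has no cancellation at the place where they meet. -/
def Junction {α : Type*} (L M : List (α × Bool)) : Prop :=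
  ∀ a ∈ L.getLast?, ∀ b ∈ M.head?, a.1 = b.1 → a.2 = b.2

theorem isReduced_append_iff {α : Type*} {L M : List (α × Bool)} :
    IsReduced (L ++ M) ↔ IsReduced L ∧ IsReduced M ∧ Junction L M :=
  List.isChain_append

/-- Translate all the generators in a word by `j`. -/
def shiftWord (j : A) (L : List (A × Bool)) : List (A × Bool) :=
  L.map fun a => (a.1 + j, a.2)

theorem shiftWord_append (j : A) (L M : List (A × Bool)) :
    shiftWord j (L ++ M) = shiftWord j L ++ shiftWord j M := by
  simp [shiftWord]

theorem shiftWord_shiftWord (i j : A) (L : List (A × Bool)) :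
    shiftWord i (shiftWord j L) = shiftWord (j + i) L := by
  simp [shiftWord, add_assoc]

theorem length_shiftWord (j : A) (L : List (A × Bool)) :
    (shiftWord j L).length = L.length := by
  simp [shiftWord]

theorem shiftWord_invRev (j : A) (L : List (A × Bool)) :
    shiftWord j (invRev L) = invRev (shiftWord j L) := by
  simp [shiftWord, invRev]

theorem isReduced_shiftWord {j : A} {L : List (A × Bool)} :
    IsReduced (shiftWord j L) ↔ IsReduced L := by
  simp [shiftWord, IsReduced, List.isChain_map]

theorem isReduced_invRev {α : Type*} {L : List (α × Bool)} :
    IsReduced (invRev L) ↔ IsReduced L := by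
  simp only [invRev, IsReduced, List.isChain_reverse, List.isChain_map]
  refine ⟨fun h => h.imp ?_, fun h => h.imp ?_⟩ <;> intro a b hab <;> grind

theorem head?_shiftWord (j : A) (L : List (A × Bool)) :
    (shiftWord j L).head? = L.head?.map fun a => (a.1 + j, a.2) := by
  simp [shiftWord]

theorem getLast?_shiftWord (j : A) (L : List (A × Bool)) :
    (shiftWord j L).getLast? = L.getLast?.map fun a => (a.1 + j, a.2) := by
  simp [shiftWord]

theorem head?_invRev {α : Type*} (L : List (α × Bool)) :
    (invRev L).head? = L.getLast?.map fun a => (a.1, !a.2) := by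
  simp [invRev]

theorem getLast?_invRev {α : Type*} (L : List (α × Bool)) :
    (invRev L).getLast? = L.head?.map fun a => (a.1, !a.2) := by
  simp [invRev]

theorem shiftWord_eq_nil {j : A} {L : List (A × Bool)} : shiftWord j L = [] ↔ L = [] := by
  simp [shiftWord]

theorem invRev_eq_nil {α : Type*} {L : List (α × Bool)} : invRev L = [] ↔ L = [] := by
  simp [invRev]

/-- Every word is a twisted conjugate of a word which is twisted cyclically reduced. -/
theorem exists_twisted_cyclic_decomposition (d : A) (L : List (A × Bool)) :
    ∃ p y, L = p ++ y ++ invRev (shiftWord d p) ∧ Junction y (shiftWord d y) := by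
  induction L using List.bidirectionalRec with
  | nil => exact ⟨[], [], by simp [shiftWord], by simp [Junction]⟩
  | singleton a => exact ⟨[], [a], by simp [shiftWord], by simp [Junction, shiftWord]⟩
  | cons_append a l b ih =>
    by_cases h : b.1 = a.1 + d → b.2 = a.2
    · refine ⟨[], a :: (l ++ [b]), by simp [shiftWord], ?_⟩
      have hlast : (a :: (l ++ [b])).getLast? = some b := by
        rw [← List.cons_append, List.getLast?_append_of_ne_nil _ (by simp)]; rfl
      simp only [Junction, head?_shiftWord, hlast, Option.mem_def, List.head?_cons,
        Option.map_some, Option.some_inj]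
      rintro _ rfl _ rfl
      exact h
    · obtain ⟨p, y, rfl, hy⟩ := ih
      refine ⟨a :: p, y, ?_, hy⟩
      have hb : b = (a.1 + d, !a.2) := by
        ext <;> grind
      simp [hb, shiftWord, invRev]

/-- The automorphism of a free group translating all the generators by `j`. -/
def shift (j : A) : FreeGroup A ≃* FreeGroup A :=
  freeGroupCongr (Equiv.addRight j)

@[simp] theorem shift_of (j i : A) : shift j (of i) = of (i + j) := by
  simp [shift, freeGroupCongr]

theorem shift_mk (j : A) (L : List (A × Bool)) : shift j (mk L) = mk (shiftWord j L) := rfl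

theorem shift_shift (i j : A) (w : FreeGroup A) : shift i (shift j w) = shift (j + i) w := by
  classical
  rw [← mk_toWord (x := w), shift_mk, shift_mk, shift_mk, shiftWord_shiftWord]

theorem shift_zero (w : FreeGroup A) : shift 0 w = w := by
  classical
  rw [← mk_toWord (x := w), shift_mk]
  simp [shiftWord]

theorem IsReduced.toWord_mk {α : Type*} [DecidableEq α] {L : List (α × Bool)}
    (h : IsReduced L) : (mk L).toWord = L := by
  rw [FreeGroup.toWord_mk, h.reduce_eq]

theorem eq_one_of_shift_eq {j : A} (hj : j ≠ 0) {w : FreeGroup A} (h : shift j w = w) :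
    w = 1 := by
  classical
  have h1 : shiftWord j w.toWord = w.toWord := by
    have h2 : IsReduced (shiftWord j w.toWord) := isReduced_shiftWord.2 isReduced_toWord
    rw [← h2.toWord_mk, ← shift_mk, mk_toWord, h]
  have h3 := head?_shiftWord j w.toWord
  rw [h1] at h3
  rw [← toWord_eq_nil_iff]
  cases hw : w.toWord with
  | nil => rfl
  | cons a l =>
    rw [hw] at h3
    simp [Prod.ext_iff, hj] at h3

end Words

section Equivariant

variable {A : Type*} [AddCommGroup A] (d : A) (p y : List (A × Bool))

/-- The reduced word representing the image of a letter. -/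
def letterImage (l : A × Bool) : List (A × Bool) :=
  shiftWord l.1 (bif l.2 then p ++ y ++ invRev (shiftWord d p)
    else invRev (p ++ y ++ invRev (shiftWord d p)))

/-- The initial part of `letterImage` that may cancel in products. -/
def letterHead (l : A × Bool) : List (A × Bool) :=
  shiftWord l.1 (bif l.2 then p else shiftWord d p)

/-- The middle part of `letterImage` which never cancels in products. -/
def letterCore (l : A × Bool) : List (A × Bool) :=
  shiftWord l.1 (bif l.2 then y else invRev y)

/-- The final part of `letterImage` that may cancel in products. -/
def letterTail (l : A × Bool) : List (A × Bool) :=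
  shiftWord l.1 (bif l.2 then invRev (shiftWord d p) else invRev p)

theorem letterImage_eq (l : A × Bool) :
    letterImage d p y l = letterHead d p l ++ letterCore y l ++ letterTail d p l := by
  obtain ⟨i, _ | _⟩ := l <;>
    simp [letterImage, letterHead, letterCore, letterTail, shiftWord_append, invRev_append,
      invRev_invRev]

theorem isReduced_letterImage (h : IsReduced (p ++ y ++ invRev (shiftWord d p)))
    (l : A × Bool) : IsReduced (letterImage d p y l) := by
  obtain ⟨i, _ | _⟩ := l
  · exact isReduced_shiftWord.2 (isReduced_invRev.2 h)
  · exact isReduced_shiftWord.2 h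

theorem letter_dichotomy (hy : Junction y (shiftWord d y))
    (hd : ∀ a ∈ (p ++ y ++ invRev (shiftWord d p)).getLast?,
      ∀ b ∈ (p ++ y ++ invRev (shiftWord d p)).head?, a.1 = b.1 + d)
    (l l' : A × Bool) (hl : l.1 = l'.1 → l.2 = l'.2) :
    (mk (letterTail d p l) * mk (letterHead d p l') = 1 ∧
      Junction (letterCore y l) (letterCore y l')) ∨
    Junction (letterImage d p y l) (letterImage d p y l') := by
  have key (i j : A) (h : i = j + d) : Junction (shiftWord j y) (shiftWord i y) := by
    subst h
    simp only [Junction, head?_shiftWord, getLast?_shiftWord, Option.mem_def,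
      Option.map_eq_some_iff] at hy ⊢
    rintro _ ⟨a, ha, rfl⟩ _ ⟨b, hb, rfl⟩ hab
    have := hy a ha (b.1 + d, b.2) ⟨b, hb, rfl⟩
    simp only at this hab ⊢
    exact this (by rw [add_comm j d, ← add_assoc] at hab; exact add_right_cancel hab)
  have hinv (L : List (A × Bool)) : mk (invRev L) * mk L = 1 := by
    rw [← inv_mk, inv_mul_cancel]
  set L := p ++ y ++ invRev (shiftWord d p) with hL
  obtain ⟨i, _ | _⟩ := l <;> obtain ⟨j, _ | _⟩ := l'
  · by_cases h : i = j + d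
    · left
      constructor
      · simp only [letterTail, letterHead, cond_false, shiftWord_invRev, shiftWord_shiftWord]
        rw [h, add_comm]
        exact hinv _
      · simp only [letterCore, cond_false, shiftWord_invRev]
        intro a ha b hb hab
        simp only [head?_invRev, getLast?_invRev, Option.mem_def, Option.map_eq_some_iff] at ha hb
        obtain ⟨a, ha, rfl⟩ := ha
        obtain ⟨b, hb, rfl⟩ := hb
        have := key i j h b hb a ha
        simp only at hab ⊢
        rw [this hab.symm]
    · right
      simp only [letterImage, cond_false, shiftWord_invRev]
      intro a ha b hb hab
      simp only [head?_invRev, getLast?_invRev, Option.mem_def, Option.map_eq_some_iff,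
        head?_shiftWord, getLast?_shiftWord] at ha hb
      obtain ⟨_, ⟨a, ha, rfl⟩, rfl⟩ := ha
      obtain ⟨_, ⟨b, hb, rfl⟩, rfl⟩ := hb
      have := hd b hb a ha
      refine absurd ?_ h
      simp only [this, add_assoc] at hab
      rw [add_comm j d]; exact add_left_cancel hab
  · have hij : i ≠ j := by grind
    right
    simp only [letterImage, cond_false, cond_true, shiftWord_invRev]
    intro a ha b hb hab
    simp only [getLast?_invRev, Option.mem_def, Option.map_eq_some_iff, head?_shiftWord] at ha hb
    obtain ⟨_, ⟨a, ha, rfl⟩, rfl⟩ := ha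
    obtain ⟨b, hb, rfl⟩ := hb
    rw [ha, Option.some_inj] at hb
    simp only [hb] at hab
    exact absurd (add_left_cancel hab) hij
  · have hij : i ≠ j := by grind
    right
    simp only [letterImage, cond_false, cond_true, shiftWord_invRev]
    intro a ha b hb hab
    simp only [head?_invRev, Option.mem_def, Option.map_eq_some_iff,
      getLast?_shiftWord] at ha hb
    obtain ⟨_, ⟨b, hb, rfl⟩, rfl⟩ := hb
    obtain ⟨a, ha, rfl⟩ := ha
    rw [ha, Option.some_inj] at hb
    simp only [hb] at hab
    exact absurd (add_left_cancel hab) hij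
  · by_cases h : j = i + d
    · left
      constructor
      · simp only [letterTail, letterHead, cond_true, shiftWord_invRev, shiftWord_shiftWord]
        rw [h, add_comm]
        exact hinv _
      · exact key j i h
    · right
      simp only [letterImage, cond_true]
      intro a ha b hb hab
      simp only [Option.mem_def, Option.map_eq_some_iff,
        head?_shiftWord, getLast?_shiftWord] at ha hb
      obtain ⟨a, ha, rfl⟩ := ha
      obtain ⟨b, hb, rfl⟩ := hb
      have := hd a ha b hb
      refine absurd ?_ h
      simp only [this, add_assoc] at hab
      rw [add_comm i d]; exact (add_left_cancel hab).symm

theorem exists_reduced_image (ψ : FreeGroup A →* FreeGroup A)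
    (hψ : ∀ l, ψ (mk [l]) = mk (letterImage d p y l)) (hy0 : y ≠ [])
    (hred : IsReduced (p ++ y ++ invRev (shiftWord d p)))
    (hy : Junction y (shiftWord d y))
    (hd : ∀ a ∈ (p ++ y ++ invRev (shiftWord d p)).getLast?,
      ∀ b ∈ (p ++ y ++ invRev (shiftWord d p)).head?, a.1 = b.1 + d)
    (l : A × Bool) (v : List (A × Bool)) (hv : IsReduced (l :: v)) :
    ∃ R, IsReduced (letterHead d p l ++ letterCore y l ++ R) ∧
      ψ (mk (l :: v)) = mk (letterHead d p l ++ letterCore y l ++ R) := by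
  have core_ne (l : A × Bool) : letterCore y l ≠ [] := by
    obtain ⟨i, _ | _⟩ := l <;> simpa [letterCore, shiftWord_eq_nil, invRev_eq_nil]
  induction v generalizing l with
  | nil =>
    refine ⟨letterTail d p l, ?_, ?_⟩
    · rw [← letterImage_eq]; exact isReduced_letterImage d p y hred l
    · rw [← letterImage_eq, hψ]
  | cons l' v ih =>
    rw [isReduced_cons_cons] at hv
    obtain ⟨R, hR, hR'⟩ := ih l' hv.2
    have hcons : ψ (mk (l :: l' :: v)) = mk (letterHead d p l ++ letterCore y l) *
        (mk (letterTail d p l) * mk (letterHead d p l')) * mk (letterCore y l' ++ R) := by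
      rw [show l :: l' :: v = [l] ++ (l' :: v) from rfl, ← mul_mk, _root_.map_mul, hR', hψ,
        letterImage_eq]
      simp only [← mul_mk, mul_assoc]
    have hW := isReduced_letterImage d p y hred l
    rcases letter_dichotomy d p y hy hd l l' hv.1 with ⟨h1, h2⟩ | h
    · refine ⟨letterCore y l' ++ R, ?_, ?_⟩
      · rw [letterImage_eq] at hW
        rw [List.append_assoc, isReduced_append_iff] at hR
        refine isReduced_append_iff.2 ⟨(isReduced_append_iff.1 hW).1, hR.2.1, ?_⟩
        intro a ha b hb
        rw [List.getLast?_append_of_ne_nil _ (core_ne l)] at ha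
        rw [List.head?_append_of_ne_nil _ (core_ne l')] at hb
        exact h2 a ha b hb
      · rw [hcons, h1, mul_one, mul_mk]
    · refine ⟨letterTail d p l ++ (letterHead d p l' ++ letterCore y l' ++ R), ?_, ?_⟩
      · rw [← List.append_assoc, ← letterImage_eq]
        refine isReduced_append_iff.2 ⟨hW, hR, ?_⟩
        intro a ha b hb
        rw [List.head?_append_of_ne_nil _ (by simp [core_ne])] at hb
        refine h a ha b ?_
        rwa [letterImage_eq, List.head?_append_of_ne_nil _ (by simp [core_ne])]
      · rw [hcons]
        simp only [← mul_mk, mul_assoc]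

/-- A translation equivariant endomorphism of a free group whose image contains a generator
permutes the generators up to inversion. -/
theorem eq_letter_of_equivariant [DecidableEq A] (ψ : FreeGroup A →* FreeGroup A) (w : FreeGroup A)
    (hψ : ∀ i, ψ (of i) = shift i w) (i₀ : A) (hi₀ : of i₀ ∈ ψ.range) :
    ∃ l : A × Bool, w = mk [l] := by
  obtain ⟨v, hv⟩ := hi₀
  obtain ⟨d, hd⟩ : ∃ d : A, ∀ a ∈ w.toWord.getLast?, ∀ b ∈ w.toWord.head?, a.1 = b.1 + d := by
    rcases hb : w.toWord.head? with _ | b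
    · exact ⟨0, by simp⟩
    · rcases ha : w.toWord.getLast? with _ | a
      · exact ⟨0, by simp⟩
      · exact ⟨a.1 - b.1, by simp⟩
  obtain ⟨p, y, hL, hy⟩ := exists_twisted_cyclic_decomposition d w.toWord
  have hred : IsReduced w.toWord := isReduced_toWord
  rw [hL] at hred hd
  have hw : w = mk (p ++ y ++ invRev (shiftWord d p)) := by rw [← hL, mk_toWord]
  have hletter (l : A × Bool) : ψ (mk [l]) = mk (letterImage d p y l) := by
    obtain ⟨i, _ | _⟩ := l
    · have : (mk [(i, false)] : FreeGroup A) = (of i)⁻¹ := rfl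
      rw [this, _root_.map_inv, hψ, hw, shift_mk, inv_mk, letterImage, cond_false, shiftWord_invRev]
    · have : (mk [(i, true)] : FreeGroup A) = of i := rfl
      rw [this, hψ, hw, shift_mk, letterImage, cond_true]
  let ε : FreeGroup A →* Multiplicative ℤ := lift fun _ => Multiplicative.ofAdd 1
  have hε (j : A) (u : FreeGroup A) : ε (shift j u) = ε u := by
    have : ε.comp (shift j).toMonoidHom = ε := by ext; simp [ε]
    exact DFunLike.congr_fun this u
  have hy0 : y ≠ [] := by
    rintro rfl
    have hw1 : ε w = 1 := by
      rw [hw, List.append_nil, ← mul_mk, ← inv_mk, ← shift_mk, _root_.map_mul, _root_.map_inv, hε,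
        mul_inv_cancel]
    have : ε.comp ψ = 1 := by ext i; simp [hψ, hε, hw1]
    have := DFunLike.congr_fun this v
    simp [hv, ε] at this
  rcases hvw : v.toWord with _ | ⟨l, t⟩
  · rw [toWord_eq_nil_iff] at hvw
    simp [hvw, one_ne_of] at hv
  · have hvr : IsReduced (l :: t) := hvw ▸ isReduced_toWord
    obtain ⟨R, hR, hR'⟩ := exists_reduced_image d p y ψ hletter hy0 hred hy hd l t hvr
    rw [← hvw, mk_toWord, hv] at hR'
    have hlen := congrArg List.length (congrArg toWord hR')
    rw [hR.toWord_mk, toWord_of] at hlen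
    have hlen' : p.length + y.length + R.length = 1 := by
      obtain ⟨i, _ | _⟩ := l <;>
        simpa [letterHead, letterCore, length_shiftWord, eq_comm, add_assoc] using hlen
    have hyp := List.length_pos_iff.2 hy0
    have hp : p = [] := List.length_eq_zero_iff.1 (by omega)
    obtain ⟨b, hb⟩ := List.length_eq_one_iff.1 (show y.length = 1 by omega)
    exact ⟨b, by simp [hw, hp, hb, shiftWord]⟩

end Equivariant

end FreeGroup

/-- The action of the infinite cyclic group on a free group of rank `k` which cyclically permutes
the generators. -/
def cyclicShift (k : ℕ) : Multiplicative ℤ →* MulAut (FreeGroup (ZMod k)) where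
  toFun n := FreeGroup.shift (n.toAdd : ZMod k)
  map_one' := by ext w; simp [FreeGroup.shift_zero]
  map_mul' m n := by ext w; simp [FreeGroup.shift_shift, add_comm]

/-- The semidirect product of a free group of rank `k` with the infinite cyclic group which
cyclically permutes the generators. -/
abbrev CyclicShiftGroup (k : ℕ) : Type := FreeGroup (ZMod k) ⋊[cyclicShift k] Multiplicative ℤ

namespace CyclicShiftGroup

open SemidirectProduct
open FreeGroup hiding map_mul map_one map_inv

variable {k : ℕ}

theorem cyclicShift_apply (n : Multiplicative ℤ) (w : FreeGroup (ZMod k)) :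
    cyclicShift k n w = shift (n.toAdd : ZMod k) w := rfl

variable (k) in
/-- The generator of `CyclicShiftGroup k` coming from the free group. -/
def s : CyclicShiftGroup k := inl (of 0)

variable (k) in
/-- The generator of `CyclicShiftGroup k` coming from the infinite cyclic group. -/
def x : CyclicShiftGroup k := inr (Multiplicative.ofAdd 1)

theorem x_zpow (n : ℤ) : x k ^ n = inr (Multiplicative.ofAdd n) := by
  rw [x, ← map_zpow, ← ofAdd_zsmul]; simp

@[simp] theorem left_x_zpow (n : ℤ) : (x k ^ n).left = 1 := by rw [x_zpow, left_inr]

@[simp] theorem right_x_zpow (n : ℤ) : (x k ^ n).right = Multiplicative.ofAdd n := by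
  rw [x_zpow, right_inr]

theorem inl_shift (n : ℤ) (w : FreeGroup (ZMod k)) :
    (inl (shift (n : ZMod k) w) : CyclicShiftGroup k) = x k ^ n * inl w * (x k ^ n)⁻¹ := by
  rw [x_zpow, ← map_inv, ← inl_aut]; rfl

theorem inl_of (n : ℤ) :
    (inl (of (n : ZMod k)) : CyclicShiftGroup k) = x k ^ n * s k * (x k ^ n)⁻¹ := by
  rw [s, ← inl_shift, shift_of, zero_add]

theorem eq_inl_mul_zpow (g : CyclicShiftGroup k) :
    g = inl g.left * x k ^ (g.right.toAdd) := by
  rw [x_zpow, ofAdd_toAdd, inl_left_mul_inr_right]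

theorem hom_ext' {K : Type*} [Group K] {f g : CyclicShiftGroup k →* K}
    (hs : f (s k) = g (s k)) (hx : f (x k) = g (x k)) : f = g := by
  refine SemidirectProduct.hom_ext ?_ ?_
  · ext i
    obtain ⟨n, rfl⟩ := ZMod.intCast_surjective i
    simp [inl_of, hs, hx]
  · ext
    exact hx

theorem commute_s_x_pow : Commute (s k) (x k ^ k) := by
  have h := inl_shift (k := k) k (of 0)
  rw [Int.cast_natCast, ZMod.natCast_self, shift_zero, zpow_natCast] at h
  exact eq_mul_inv_iff_mul_eq.1 h

section Lift

variable {K : Type*} [Group K]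

theorem conj_zpow_eq_of_cast_eq {a b : K} (h : Commute a (b ^ k)) {m n : ℤ}
    (hmn : (m : ZMod k) = n) : b ^ m * a * (b ^ m)⁻¹ = b ^ n * a * (b ^ n)⁻¹ := by
  obtain ⟨c, hc⟩ := (ZMod.intCast_eq_intCast_iff_dvd_sub m n k).1 hmn
  obtain rfl : n = m + k * c := by omega
  have hb : Commute a (b ^ ((k : ℤ) * c)) := by
    rw [zpow_mul, zpow_natCast]; exact h.zpow_right c
  rw [zpow_add, mul_assoc (b ^ m) _ a, ← hb.eq]
  group

/-- The universal property of `CyclicShiftGroup k`: it is presented by two generators `s` and `x`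
such that `s` commutes with `x ^ k`. -/
noncomputable def lift (a b : K) (h : Commute a (b ^ k)) : CyclicShiftGroup k →* K :=
  SemidirectProduct.lift
    (FreeGroup.lift fun i : ZMod k => b ^ (i.cast : ℤ) * a * (b ^ (i.cast : ℤ))⁻¹)
    (zpowersHom K b) (fun n => by
      ext i
      simp only [MonoidHom.comp_apply, MulEquiv.coe_toMonoidHom, cyclicShift_apply, shift_of,
        FreeGroup.lift_apply_of, MulAut.conj_apply, zpowersHom_apply]
      rw [conj_zpow_eq_of_cast_eq h (n := n.toAdd + (i.cast : ℤ)) (by simp [add_comm]), zpow_add]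
      group)

@[simp] theorem lift_s (a b : K) (h : Commute a (b ^ k)) : lift a b h (s k) = a := by
  simp only [lift, s, lift_inl, FreeGroup.lift_apply_of]
  rw [conj_zpow_eq_of_cast_eq h (n := 0) (by simp)]
  simp

@[simp] theorem lift_x (a b : K) (h : Commute a (b ^ k)) : lift a b h (x k) = b := by
  simp [lift, x]

end Lift

variable (k) in
/-- The exponent sum of the generator `s`. -/
noncomputable def sExp : CyclicShiftGroup k →* Multiplicative ℤ :=
  lift (Multiplicative.ofAdd 1) 1 (Commute.all _ _)

variable (k) in
/-- The exponent sum of the generator `x`. -/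
def xExp : CyclicShiftGroup k →* Multiplicative ℤ := rightHom

@[simp] theorem sExp_s : sExp k (s k) = Multiplicative.ofAdd 1 := by simp [sExp]
@[simp] theorem sExp_x : sExp k (x k) = 1 := by simp [sExp]
@[simp] theorem xExp_s : xExp k (s k) = 1 := by simp [xExp, s]
@[simp] theorem xExp_x : xExp k (x k) = Multiplicative.ofAdd 1 := by simp [xExp, x]

theorem left_eq_one_of_commute (hk : 2 ≤ k) {g : CyclicShiftGroup k} (h : Commute (x k) g) :
    g.left = 1 := by
  have : Fact (1 < k) := ⟨hk⟩
  have h1 := congrArg SemidirectProduct.left h.eq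
  simp only [mul_left, x, left_inr, right_inr, one_mul, map_one, mul_one, cyclicShift_apply,
    toAdd_ofAdd, Int.cast_one] at h1
  exact eq_one_of_shift_eq one_ne_zero h1

theorem exists_word_pow_succ {y : List (ZMod k × Bool)} (hy0 : y ≠ []) (hr : IsReduced y) (n : ℤ)
    (hy : Junction y (shiftWord (n : ZMod k) y)) (j : ℕ) :
    ∃ Y, IsReduced Y ∧ Y.head? = y.head? ∧
      ((inl (mk y) * x k ^ n : CyclicShiftGroup k) ^ (j + 1)).left = mk Y := by
  induction j with
  | zero => exact ⟨y, hr, rfl, by simp⟩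
  | succ j ih =>
    obtain ⟨Y, hY, hhead, hYe⟩ := ih
    refine ⟨y ++ shiftWord (n : ZMod k) Y, ?_, List.head?_append_of_ne_nil _ hy0, ?_⟩
    · refine isReduced_append_iff.2 ⟨hr, isReduced_shiftWord.2 hY, ?_⟩
      rwa [Junction, head?_shiftWord, hhead, ← head?_shiftWord]
    · rw [pow_succ', mul_left, hYe]
      simp [cyclicShift_apply, shift_mk]

/-- An element whose `k`-th power is a power of `x` is conjugate to a power of `x`. -/
theorem exists_conj_of_left_pow_eq_one (hk : k ≠ 0) {g : CyclicShiftGroup k}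
    (h : (g ^ k).left = 1) :
    ∃ u : CyclicShiftGroup k, g = u * x k ^ (xExp k g).toAdd * u⁻¹ := by
  set n : ℤ := (xExp k g).toAdd with hn
  obtain ⟨p, y, hL, hy⟩ := exists_twisted_cyclic_decomposition (n : ZMod k) g.left.toWord
  have hg : g = inl (mk p) * (inl (mk y) * x k ^ n) * (inl (mk p))⁻¹ := by
    have h1 := inl_shift n (mk p)
    rw [eq_mul_inv_iff_mul_eq] at h1
    have h2 : g.left = mk p * mk y * (shift (n : ZMod k) (mk p))⁻¹ := by
      rw [shift_mk, inv_mk, mul_mk, mul_mk, ← hL, mk_toWord]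
    rw [eq_inl_mul_zpow g, h2, eq_mul_inv_iff_mul_eq]
    change _ * x k ^ n * _ = _
    simp only [map_mul, map_inv, mul_assoc] at h1 ⊢
    rw [← h1]
    group
  by_cases hy0 : y = []
  · refine ⟨inl (mk p), ?_⟩
    rw [hg]
    simp [hy0, ← one_eq_mk]
  · exfalso
    have hr : IsReduced y := by
      have : IsReduced g.left.toWord := isReduced_toWord
      rw [hL] at this
      exact (isReduced_append_iff.1 (isReduced_append_iff.1 this).1).2.1
    obtain ⟨j, rfl⟩ := Nat.exists_eq_succ_of_ne_zero hk
    obtain ⟨Y, hY, hhead, hYe⟩ := exists_word_pow_succ hy0 hr n hy j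
    rw [hg, conj_pow] at h
    have hr' : ((inl (mk y) * x (j + 1) ^ n : CyclicShiftGroup (j + 1)) ^ (j + 1)).right =
        Multiplicative.ofAdd (n * (j + 1 : ℕ)) := by
      rw [← rightHom_eq_right, map_pow, map_mul, rightHom_inl, one_mul, rightHom_eq_right,
        right_x_zpow, ← ofAdd_nsmul]
      simp [mul_comm]
    simp only [Nat.succ_eq_add_one, mul_left, left_inl, mul_right, right_inl, one_mul, inv_left,
      hYe, map_one, inv_one, hr', cyclicShift_apply, MulAut.one_apply, toAdd_ofAdd] at h
    rw [Int.cast_mul, Int.cast_natCast, ZMod.natCast_self, mul_zero, shift_zero, mul_inv_eq_one,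
      mul_eq_left, one_eq_mk] at h
    have := congrArg toWord h
    rw [hY.toWord_mk, ← one_eq_mk, toWord_one] at this
    rw [this] at hhead
    exact hy0 (List.head?_eq_none_iff.1 hhead.symm)

section Aut

theorem exists_apply_x_eq_conj (hk : 2 ≤ k) (φ : MulAut (CyclicShiftGroup k)) :
    ∃ u : CyclicShiftGroup k, φ (x k) = u * x k ^ (xExp k (φ (x k))).toAdd * u⁻¹ := by
  refine exists_conj_of_left_pow_eq_one (by omega) (left_eq_one_of_commute hk ?_)
  have hz (g : CyclicShiftGroup k) : Commute g (x k ^ k) := by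
    have : (MulAut.conj (x k ^ k)).toMonoidHom = MonoidHom.id (CyclicShiftGroup k) := by
      refine hom_ext' ?_ ?_
      · exact mul_inv_eq_iff_eq_mul.2 commute_s_x_pow.eq.symm
      · exact mul_inv_eq_iff_eq_mul.2 (Commute.pow_self (x k) k).eq
    have := DFunLike.congr_fun this g
    simp only [MulEquiv.coe_toMonoidHom, MulAut.conj_apply, MonoidHom.id_apply,
      mul_inv_eq_iff_eq_mul] at this
    exact this.symm
  have := (hz (φ.symm (x k))).map φ
  rwa [MulEquiv.apply_symm_apply, map_pow] at this

theorem sExp_apply_x (hk : 2 ≤ k) (φ : MulAut (CyclicShiftGroup k)) : sExp k (φ (x k)) = 1 := by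
  obtain ⟨u, hu⟩ := exists_apply_x_eq_conj hk φ
  rw [hu]
  simp

/-- The exponent of `s` in the image of `s` under an automorphism. -/
noncomputable def ss (φ : MulAut (CyclicShiftGroup k)) : ℤ := (sExp k (φ (s k))).toAdd

/-- The exponent of `x` in the image of `s` under an automorphism. -/
noncomputable def xs (φ : MulAut (CyclicShiftGroup k)) : ℤ := (xExp k (φ (s k))).toAdd

/-- The exponent of `x` in the image of `x` under an automorphism. -/
noncomputable def xx (φ : MulAut (CyclicShiftGroup k)) : ℤ := (xExp k (φ (x k))).toAdd

theorem sExp_apply (hk : 2 ≤ k) (φ : MulAut (CyclicShiftGroup k)) (g : CyclicShiftGroup k) :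
    (sExp k (φ g)).toAdd = ss φ * (sExp k g).toAdd := by
  have : (sExp k).comp φ.toMonoidHom = (zpowGroupHom (ss φ)).comp (sExp k) := by
    refine hom_ext' ?_ ?_
    · simp [ss, ← ofAdd_zsmul]
    · simp [sExp_apply_x hk]
  simpa using congrArg Multiplicative.toAdd (DFunLike.congr_fun this g)

theorem xExp_apply (φ : MulAut (CyclicShiftGroup k)) (g : CyclicShiftGroup k) :
    (xExp k (φ g)).toAdd = xx φ * (xExp k g).toAdd + xs φ * (sExp k g).toAdd := by
  have : (xExp k).comp φ.toMonoidHom =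
      (zpowGroupHom (xx φ)).comp (xExp k) * (zpowGroupHom (xs φ)).comp (sExp k) := by
    refine hom_ext' ?_ ?_
    · simp [xs, ← ofAdd_zsmul]
    · simp [xx, ← ofAdd_zsmul]
  simpa using congrArg Multiplicative.toAdd (DFunLike.congr_fun this g)

theorem ss_mul (hk : 2 ≤ k) (φ ψ : MulAut (CyclicShiftGroup k)) : ss (φ * ψ) = ss φ * ss ψ :=
  sExp_apply hk φ _

theorem xs_mul (φ ψ : MulAut (CyclicShiftGroup k)) :
    xs (φ * ψ) = xx φ * xs ψ + xs φ * ss ψ :=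
  xExp_apply φ _

theorem xx_mul (hk : 2 ≤ k) (φ ψ : MulAut (CyclicShiftGroup k)) : xx (φ * ψ) = xx φ * xx ψ := by
  have h := xExp_apply φ (ψ (x k))
  rwa [sExp_apply_x hk, toAdd_one, mul_zero, add_zero] at h

theorem ss_eq_or (hk : 2 ≤ k) (φ : MulAut (CyclicShiftGroup k)) : ss φ = 1 ∨ ss φ = -1 := by
  rw [← Int.isUnit_iff]
  refine IsUnit.of_mul_eq_one (ss φ⁻¹) ?_
  rw [← ss_mul hk, mul_inv_cancel]
  simp [ss]

theorem xx_eq_or (hk : 2 ≤ k) (φ : MulAut (CyclicShiftGroup k)) : xx φ = 1 ∨ xx φ = -1 := by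
  rw [← Int.isUnit_iff]
  refine IsUnit.of_mul_eq_one (xx φ⁻¹) ?_
  rw [← xx_mul hk, mul_inv_cancel]
  simp [xx]

theorem exists_eq_conj (hk : 2 ≤ k) {φ : MulAut (CyclicShiftGroup k)} (hss : ss φ = 1)
    (hxx : xx φ = 1) (hxs : xs φ = 0) : ∃ g, MulAut.conj g = φ := by
  obtain ⟨u, hu⟩ := exists_apply_x_eq_conj hk φ
  obtain ⟨ψ, rfl⟩ : ∃ ψ, φ = MulAut.conj u * ψ := ⟨(MulAut.conj u)⁻¹ * φ, by group⟩
  change _ = u * x k ^ xx _ * _ at hu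
  rw [hxx, zpow_one, MulAut.mul_apply, ← MulAut.conj_apply,
    (MulAut.conj u).injective.eq_iff] at hu
  have hss' : (sExp k (ψ (s k))).toAdd = 1 := by
    rw [← hss]; simp [ss]
  have hxs' : (xExp k (ψ (s k))).toAdd = 0 := by
    rw [← hxs]; simp [xs]
  set w := (ψ (s k)).left with hw
  have hψs : ψ (s k) = inl w := by
    rw [eq_inl_mul_zpow (ψ (s k))]
    change _ * x k ^ (xExp k (ψ (s k))).toAdd = _
    rw [hxs', zpow_zero, mul_one]
  let θ : FreeGroup (ZMod k) →* FreeGroup (ZMod k) := FreeGroup.lift fun i => shift i w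
  have hθ (v : FreeGroup (ZMod k)) : ψ (inl v) = inl (θ v) := by
    have : ψ.toMonoidHom.comp inl = inl.comp θ := by
      ext1 i
      obtain ⟨n, rfl⟩ := ZMod.intCast_surjective i
      simp [θ, inl_of, inl_shift, hu, hψs]
    exact DFunLike.congr_fun this v
  have h0 : of (0 : ZMod k) ∈ θ.range := by
    obtain ⟨g, hg⟩ := ψ.surjective (s k)
    have h1 : θ g.left = of 0 := by
      rw [eq_inl_mul_zpow g, map_mul, hθ, map_zpow, hu] at hg
      simpa [s] using congrArg SemidirectProduct.left hg
    exact ⟨_, h1⟩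
  obtain ⟨⟨i, b⟩, hl⟩ := eq_letter_of_equivariant θ w (by simp [θ]) 0 h0
  obtain ⟨n, rfl⟩ := ZMod.intCast_surjective i
  have hb : ψ (s k) = x k ^ n * s k * (x k ^ n)⁻¹ := by
    rw [hψs, hl, ← inl_of]
    cases b
    · exfalso
      have h2 : (mk [((n : ZMod k), false)] : FreeGroup (ZMod k)) = (of (n : ZMod k))⁻¹ := rfl
      rw [hψs, hl, h2, map_inv, inl_of] at hss'
      simp at hss'
    · rfl
  refine ⟨u * x k ^ n, ?_⟩
  rw [map_mul, mul_right_inj]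
  refine MulEquiv.toMonoidHom_injective (hom_ext' ?_ ?_)
  · exact hb.symm
  · exact (mul_inv_eq_iff_eq_mul.2 ((Commute.refl (x k)).zpow_left n).eq).trans hu.symm

/-- The sign `-1` corresponds to the nontrivial element of the cyclic group of order two. -/
def signElement (a : ℤ) : Multiplicative (ZMod 2) :=
  if a = 1 then 1 else Multiplicative.ofAdd 1

/-- The element of the infinite dihedral group acting on the integers by `t ↦ a * t + b`,
for `a = 1` or `a = -1`. -/
def dihedralElement (a b : ℤ) : DihedralGroup 0 :=
  if a = 1 then .r (b : ZMod 0) else .sr ((-b : ℤ) : ZMod 0)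

theorem signElement_mul {a b : ℤ} (ha : a = 1 ∨ a = -1) (hb : b = 1 ∨ b = -1) :
    signElement (a * b) = signElement a * signElement b := by
  rcases ha with rfl | rfl <;> rcases hb with rfl | rfl <;> decide

theorem dihedralElement_mul {a a' : ℤ} (b b' : ℤ) (ha : a = 1 ∨ a = -1)
    (ha' : a' = 1 ∨ a' = -1) :
    dihedralElement (a * a') (a * b' + b) = dihedralElement a b * dihedralElement a' b' := by
  rcases ha with rfl | rfl <;> rcases ha' with rfl | rfl
  · exact congrArg (DihedralGroup.r (n := 0)) (by ring : 1 * b' + b = b + b')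
  · exact congrArg (DihedralGroup.sr (n := 0)) (by ring : -(1 * b' + b) = -b' - b)
  · exact congrArg (DihedralGroup.sr (n := 0)) (by ring : -(-1 * b' + b) = -b + b')
  · exact congrArg (DihedralGroup.r (n := 0)) (by ring : -1 * b' + b = -b' - -b)

/-- The action of automorphisms on the abelianization, which determines them up to inner
automorphisms. -/
noncomputable def autInvariant (hk : 2 ≤ k) :
    MulAut (CyclicShiftGroup k) →* Multiplicative (ZMod 2) × DihedralGroup 0 :=
  MonoidHom.mk' (fun φ => (signElement (ss φ), dihedralElement (xx φ * ss φ) (xs φ * ss φ))) <| by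
    intro φ ψ
    have h (φ : MulAut (CyclicShiftGroup k)) : xx φ * ss φ = 1 ∨ xx φ * ss φ = -1 := by
      rcases xx_eq_or hk φ with h | h <;> rcases ss_eq_or hk φ with h' | h' <;> simp [h, h']
    have h2 : ss ψ * ss ψ = 1 := by
      rcases ss_eq_or hk ψ with h' | h' <;> simp [h']
    rw [Prod.mk_mul_mk, ← signElement_mul (ss_eq_or hk φ) (ss_eq_or hk ψ),
      ← dihedralElement_mul _ _ (h φ) (h ψ), ss_mul hk, xx_mul hk, xs_mul]
    congr 2
    · ring
    · linear_combination xs φ * ss φ * h2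

theorem autInvariant_apply (hk : 2 ≤ k) (φ : MulAut (CyclicShiftGroup k)) :
    autInvariant hk φ = (signElement (ss φ), dihedralElement (xx φ * ss φ) (xs φ * ss φ)) := rfl

theorem ker_autInvariant (hk : 2 ≤ k) :
    (autInvariant hk).ker = innerAutSubgroup (CyclicShiftGroup k) := by
  ext φ
  rw [MonoidHom.mem_ker, autInvariant_apply, innerAutSubgroup, MonoidHom.mem_range]
  constructor
  · intro h
    obtain ⟨h1, h2⟩ := Prod.mk.inj h
    have hss : ss φ = 1 := by
      by_contra hss
      rw [signElement, if_neg hss] at h1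
      exact absurd h1 (by decide)
    rw [hss, mul_one, mul_one, dihedralElement, DihedralGroup.one_def] at h2
    split_ifs at h2 with hxx
    exact exists_eq_conj hk hss hxx (Int.cast_eq_zero.1 (DihedralGroup.r.inj h2))
  · rintro ⟨g, rfl⟩
    have h1 : ss (MulAut.conj g) = 1 := by simp [ss]
    have h2 : xx (MulAut.conj g) = 1 := by simp [xx]
    have h3 : xs (MulAut.conj g) = 0 := by simp [xs]
    rw [h1, h2, h3]
    rfl

variable (k) in
/-- The automorphism fixing `x` and sending `s` to `s * x ^ c`. -/
noncomputable def transvection (c : ℤ) : MulAut (CyclicShiftGroup k) :=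
  have h (c : ℤ) : Commute (s k * x k ^ c) (x k ^ k) :=
    commute_s_x_pow.mul_left (((Commute.refl (x k)).zpow_left c).pow_right k)
  MonoidHom.toMulEquiv (lift (s k * x k ^ c) (x k) (h c)) (lift (s k * x k ^ (-c)) (x k) (h (-c)))
    (hom_ext' (by simp) (by simp)) (hom_ext' (by simp) (by simp))

variable (k) in
/-- The automorphism fixing `s` and inverting `x`. -/
noncomputable def invX : MulAut (CyclicShiftGroup k) :=
  have h : Commute (s k) ((x k)⁻¹ ^ k) := by
    rw [inv_pow]; exact commute_s_x_pow.inv_right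
  MonoidHom.toMulEquiv (lift (s k) (x k)⁻¹ h) (lift (s k) (x k)⁻¹ h)
    (hom_ext' (by simp) (by simp)) (hom_ext' (by simp) (by simp))

variable (k) in
/-- The automorphism fixing `x` and inverting `s`. -/
noncomputable def invS : MulAut (CyclicShiftGroup k) :=
  have h : Commute (s k)⁻¹ (x k ^ k) := commute_s_x_pow.inv_left
  MonoidHom.toMulEquiv (lift (s k)⁻¹ (x k) h) (lift (s k)⁻¹ (x k) h)
    (hom_ext' (by simp) (by simp)) (hom_ext' (by simp) (by simp))

theorem autInvariant_transvection (hk : 2 ≤ k) (c : ℤ) :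
    autInvariant hk (transvection k c) = (1, .r (c : ZMod 0)) := by
  have h1 : ss (transvection k c) = 1 := by simp [ss, transvection]
  have h2 : xx (transvection k c) = 1 := by simp [xx, transvection]
  have h3 : xs (transvection k c) = c := by simp [xs, transvection]
  rw [autInvariant_apply, h1, h2, h3, mul_one, mul_one]
  rfl

theorem autInvariant_invX (hk : 2 ≤ k) : autInvariant hk (invX k) = (1, .sr 0) := by
  have h1 : ss (invX k) = 1 := by simp [ss, invX]
  have h2 : xx (invX k) = -1 := by simp [xx, invX]
  have h3 : xs (invX k) = 0 := by simp [xs, invX]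
  rw [autInvariant_apply, h1, h2, h3]
  rfl

theorem autInvariant_invS (hk : 2 ≤ k) :
    autInvariant hk (invS k) = (Multiplicative.ofAdd 1, .sr 0) := by
  have h1 : ss (invS k) = -1 := by simp [ss, invS]
  have h2 : xx (invS k) = 1 := by simp [xx, invS]
  have h3 : xs (invS k) = 0 := by simp [xs, invS]
  rw [autInvariant_apply, h1, h2, h3]
  rfl

theorem autInvariant_surjective (hk : 2 ≤ k) : Function.Surjective (autInvariant hk) := by
  rw [← MonoidHom.range_eq_top, eq_top_iff]
  have hr (c : ZMod 0) : (1, DihedralGroup.r c) ∈ (autInvariant hk).range :=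
    ⟨transvection k c, autInvariant_transvection hk c⟩
  have hx : (1, DihedralGroup.sr 0) ∈ (autInvariant hk).range := ⟨invX k, autInvariant_invX hk⟩
  have hd (d : DihedralGroup 0) : (1, d) ∈ (autInvariant hk).range := by
    rcases d with c | c
    · exact hr c
    · simpa using mul_mem hx (hr c)
  rintro ⟨t, d⟩ -
  obtain rfl | rfl : t = 1 ∨ t = Multiplicative.ofAdd 1 := by decide +revert
  · exact hd d
  · have hs : (Multiplicative.ofAdd 1, DihedralGroup.sr 0) ∈ (autInvariant hk).range :=
      ⟨invS k, autInvariant_invS hk⟩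
    have := mul_mem hs (hd ((.sr 0)⁻¹ * d))
    rwa [Prod.mk_mul_mk, mul_inv_cancel_left, mul_one] at this

/-- The outer automorphism group of `CyclicShiftGroup k`. -/
noncomputable def outEquiv (hk : 2 ≤ k) :
    Out (CyclicShiftGroup k) ≃* Multiplicative (ZMod 2) × DihedralGroup 0 :=
  (QuotientGroup.quotientMulEquivOfEq (ker_autInvariant hk).symm).trans
    (QuotientGroup.quotientKerEquivOfSurjective _ (autInvariant_surjective hk))

end Aut

end CyclicShiftGroup

/-- Isomorphic groups have isomorphic outer automorphism groups. -/
def Out.congr {G H : Type*} [Group G] [Group H] (e : G ≃* H) : Out G ≃* Out H :=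
  QuotientGroup.congr _ _ (MulAut.congr e) <| by
    rw [innerAutSubgroup, innerAutSubgroup, MonoidHom.map_range]
    ext φ
    simp only [MonoidHom.mem_range]
    refine ⟨?_, ?_⟩
    · rintro ⟨g, rfl⟩
      exact ⟨e g, by ext h; simp [MulAut.congr]⟩
    · rintro ⟨g, rfl⟩
      exact ⟨e.symm g, by ext h; simp [MulAut.congr]⟩

theorem altProd_add_self {M : Type*} [Monoid M] (a b : M) (k : ℕ) :
    altProd a b (k + k) = (a * b) ^ k := by
  induction k with
  | zero => rw [add_zero, pow_zero, altProd]
  | succ k ih =>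
    rw [show k + 1 + (k + 1) = k + k + 1 + 1 by ring, altProd, altProd, ih, pow_succ', mul_assoc]

theorem map_altProd {M N : Type*} [Monoid M] [Monoid N] (f : M →* N) (a b : M) (n : ℕ) :
    f (altProd a b n) = altProd (f a) (f b) n := by
  induction n generalizing a b with
  | zero => exact map_one f
  | succ n ih => rw [altProd, altProd, map_mul, ih]

theorem mul_pow_eq_mul_pow_swap_iff {G : Type*} [Group G] (a b : G) (k : ℕ) :
    (a * b) ^ k = (b * a) ^ k ↔ Commute a ((a * b) ^ k) := by
  rw [show b * a = a⁻¹ * (a * b) * a⁻¹⁻¹ by group, conj_pow, inv_inv, mul_assoc,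
    eq_inv_mul_iff_mul_eq]
  rfl

namespace DihedralArtinGroup

open CyclicShiftGroup

/-- A dihedral Artin group of even type is presented by `s` and `x = s * t` such that `s` commutes
with a power of `x`. -/
noncomputable def equivCyclicShiftGroup (k : ℕ) :
    DihedralArtinGroup (k + k) ≃* CyclicShiftGroup k :=
  MonoidHom.toMulEquiv
    (PresentedGroup.toGroup (f := fun b => bif b then s k else (s k)⁻¹ * x k) (by
      rintro _ rfl
      rw [map_mul, map_inv, map_altProd, map_altProd, altProd_add_self, altProd_add_self,
        mul_inv_eq_one, mul_pow_eq_mul_pow_swap_iff]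
      simpa using commute_s_x_pow))
    (lift (PresentedGroup.of true) (PresentedGroup.of true * PresentedGroup.of false) (by
      rw [← mul_pow_eq_mul_pow_swap_iff, ← altProd_add_self, ← altProd_add_self]
      have h := PresentedGroup.one_of_mem (rels := dihedralArtinRels (k + k)) rfl
      rwa [map_mul, map_inv, map_altProd, map_altProd, mul_inv_eq_one] at h))
    (PresentedGroup.ext fun b => by cases b <;> simp)
    (hom_ext' (by simp) (by simp))

end DihedralArtinGroup

/-- For even `m ≥ 4`, the outer automorphism group of the dihedral Artin group `DA_m` is
isomorphic to `C₂ × D∞`, the direct product of the cyclic group of order 2 with the infinite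
dihedral group. -/
theorem out_dihedralArtin_even (m : ℕ) (hm : 4 ≤ m) (heven : Even m) :
    Nonempty (Out (DihedralArtinGroup m) ≃* Multiplicative (ZMod 2) × DihedralGroup 0) := by
  obtain ⟨k, rfl⟩ := heven
  exact ⟨(Out.congr (DihedralArtinGroup.equivCyclicShiftGroup k)).trans
    (CyclicShiftGroup.outEquiv (by omega))⟩
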